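/- Fix g = 2h+ε ≥ 5 with 0 ≤ ε ≤ 1, set n = h+3+ε and δ = h+2ε. Let p, p_1, …, p_δ be general points in P^2. Then the linear system L_{n−2}(p^{n−6}, p_1^2, …, p_δ^2) of plane curves of degree n−2 with multiplicity at least n−6 at p and multiplicity at least 2 at p_1, …, p_δ has the expected dimension, namely (n−2)(n+1)/2 − (n−6)(n−5)/2 − 3δ = 2h−1−ε. -/

import Mathlib

/-!
Statement 7 (Claim 3.1 of the paper).

Fix `g = 2h + ε ≥ 5` with `0 ≤ ε ≤ 1`, set `n = h + 3 + ε` and `δ = h + 2ε`.  Let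
`p, p₁, …, p_δ` be general points in `ℙ²`.  Then the linear system
`L_{n−2}(p^{n−6}, p₁², …, p_δ²)` of plane curves of degree `n − 2` with multiplicity at
least `n − 6` at `p` and at least `2` at `p₁, …, p_δ` has the expected dimension,
namely `(n−2)(n+1)/2 − (n−6)(n−5)/2 − 3δ = 2h − 1 − ε`.

We work concretely in an affine chart `𝔸² ⊆ ℙ²` containing the (general) points: plane
curves of degree `d` are polynomials in `ℂ[x,y]` of total degree `≤ d`, the condition
"multiplicity `≥ m` at `p`" is the vanishing of all homogeneous components of degree
`< m` of the polynomial translated to `p`, and the (projective) dimension of a linear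
system is one less than the `ℂ`-dimension of the corresponding subspace of
polynomials.  "General points" is formalized by a dense open set of configurations
(recall that a dense Zariski-open set of configurations is in particular dense and
open for the classical topology used here).
-/

open MvPolynomial

/-- Translation of a polynomial in two variables: `f(x,y) ↦ f(x + p₀, y + p₁)`, as a
linear map. -/
noncomputable def translateBy (p : Fin 2 → ℂ) :
    MvPolynomial (Fin 2) ℂ →ₗ[ℂ] MvPolynomial (Fin 2) ℂ :=
  (aeval (fun i => X i + C (p i)) :
    MvPolynomial (Fin 2) ℂ →ₐ[ℂ] MvPolynomial (Fin 2) ℂ).toLinearMap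

/-- The (linear) condition that a plane curve has multiplicity at least `m` at the
point `p`: all homogeneous components of degree `< m` of the translate of `f` to `p`
vanish. -/
noncomputable def multAtLeast (m : ℕ) (p : Fin 2 → ℂ) :
    Submodule ℂ (MvPolynomial (Fin 2) ℂ) :=
  ⨅ k ∈ Finset.range m, LinearMap.ker ((homogeneousComponent k) ∘ₗ translateBy p)

/-- The linear system `L_d(p^{m}, p₁², …, p_δ²)` of plane curves of degree `d` with a
point of multiplicity at least `m` at `p` and singular at `p₁, …, p_δ`, as a subspace
of the space of polynomials of degree at most `d`. -/
noncomputable def planeSystem (d m δ : ℕ) (p : Fin 2 → ℂ) (ps : Fin δ → Fin 2 → ℂ) :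
    Submodule ℂ (MvPolynomial (Fin 2) ℂ) :=
  restrictTotalDegree (Fin 2) ℂ d ⊓ multAtLeast m p ⊓ ⨅ i, multAtLeast 2 (ps i)

/-! ### Translations and jets -/

theorem translateBy_apply (p : Fin 2 → ℂ) (f : MvPolynomial (Fin 2) ℂ) :
    translateBy p f = aeval (fun i => X i + C (p i)) f := rfl

theorem translateBy_zero : translateBy 0 = LinearMap.id := by
  ext1 s
  ext1
  simp [translateBy_apply]

theorem translateBy_translateBy (p q : Fin 2 → ℂ) (f : MvPolynomial (Fin 2) ℂ) :
    translateBy p (translateBy q f) = translateBy (p + q) f := by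
  simp only [translateBy_apply]
  rw [← AlgHom.comp_apply]
  congr 1
  ext1 i
  simp [add_assoc]

theorem eval_zero_translateBy (p : Fin 2 → ℂ) (f : MvPolynomial (Fin 2) ℂ) :
    eval 0 (translateBy p f) = eval p f := by
  rw [translateBy_apply]
  induction f using MvPolynomial.induction_on with
  | C a => simp
  | add f g hf hg => simp only [map_add, hf, hg]
  | mul_X f i hf =>
    rw [map_mul, map_mul, map_mul, hf]
    simp

theorem pderiv_translateBy (i : Fin 2) (p : Fin 2 → ℂ) (f : MvPolynomial (Fin 2) ℂ) :
    pderiv i (translateBy p f) = translateBy p (pderiv i f) := by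
  simp only [translateBy_apply]
  induction f using MvPolynomial.induction_on with
  | C a => simp
  | add f g hf hg => simp only [map_add, hf, hg]
  | mul_X f j hf =>
    simp only [map_mul, Derivation.leibniz, smul_eq_mul, hf, aeval_X, map_add, pderiv_C, add_zero]
    by_cases h : j = i
    · subst h; simp
    · simp [pderiv_X_of_ne h]

theorem totalDegree_translateBy_le (p : Fin 2 → ℂ) (f : MvPolynomial (Fin 2) ℂ) :
    (translateBy p f).totalDegree ≤ f.totalDegree := by
  rw [translateBy_apply, aeval_def, eval₂_eq]
  refine totalDegree_finsetSum_le fun s hs => ?_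
  refine (totalDegree_mul _ _).trans ?_
  rw [algebraMap_eq, totalDegree_C, zero_add]
  refine (totalDegree_finsetProd _ _).trans (le_trans ?_ (le_totalDegree hs))
  refine Finset.sum_le_sum fun i _ => (totalDegree_pow _ _).trans ?_
  refine mul_le_of_le_one_right (Nat.zero_le _) ((totalDegree_add _ _).trans ?_)
  simp

/-- Translation as a linear automorphism. -/
noncomputable def translateEquiv (p : Fin 2 → ℂ) :
    MvPolynomial (Fin 2) ℂ ≃ₗ[ℂ] MvPolynomial (Fin 2) ℂ :=
  LinearEquiv.ofLinearMap (translateBy p) (translateBy (-p))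
    (by ext1 s; ext1; simp [translateBy_translateBy, translateBy_zero])
    (by ext1 s; ext1; simp [translateBy_translateBy, translateBy_zero])

theorem mem_multAtLeast {m : ℕ} {p : Fin 2 → ℂ} {f : MvPolynomial (Fin 2) ℂ} :
    f ∈ multAtLeast m p ↔ ∀ k < m, homogeneousComponent k (translateBy p f) = 0 := by
  simp [multAtLeast, Submodule.mem_iInf]

theorem mem_planeSystem_iff_translateBy {d m δ : ℕ} {p : Fin 2 → ℂ} {ps : Fin δ → Fin 2 → ℂ}
    {f : MvPolynomial (Fin 2) ℂ} :
    f ∈ planeSystem d m δ p ps ↔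
      translateBy p f ∈ planeSystem d m δ 0 (fun i => ps i - p) := by
  have hdeg : (translateBy p f).totalDegree = f.totalDegree := by
    refine le_antisymm (totalDegree_translateBy_le p f) ?_
    simpa [translateBy_translateBy, translateBy_zero] using
      totalDegree_translateBy_le (-p) (translateBy p f)
  simp [planeSystem, Submodule.mem_iInf, mem_restrictTotalDegree, mem_multAtLeast,
    translateBy_translateBy, hdeg]

theorem finrank_planeSystem_translate {d m δ : ℕ} (p : Fin 2 → ℂ) (ps : Fin δ → Fin 2 → ℂ) :
    Module.finrank ℂ (planeSystem d m δ p ps) =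
      Module.finrank ℂ (planeSystem d m δ 0 (fun i => ps i - p)) := by
  have : planeSystem d m δ 0 (fun i => ps i - p) =
      (planeSystem d m δ p ps).map (translateEquiv p).toLinearMap := by
    ext f
    have hf : translateBy p ((translateEquiv p).symm f) = f :=
      (translateEquiv p).apply_symm_apply f
    rw [Submodule.mem_map_equiv, mem_planeSystem_iff_translateBy (p := p), hf]
  rw [this, LinearEquiv.finrank_map_eq]

/-- The operators sending a polynomial to itself and to its two partial derivatives. -/
noncomputable def jetOp : Fin 3 → MvPolynomial (Fin 2) ℂ →ₗ[ℂ] MvPolynomial (Fin 2) ℂ :=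
  ![LinearMap.id, (pderiv 0).toLinearMap, (pderiv 1).toLinearMap]

/-- The values and first partial derivatives of a polynomial at a family of points. -/
noncomputable def jetMap {δ : ℕ} (ps : Fin δ → Fin 2 → ℂ) :
    MvPolynomial (Fin 2) ℂ →ₗ[ℂ] (Fin δ × Fin 3 → ℂ) :=
  LinearMap.pi fun ik => (aeval (R := ℂ) (ps ik.1)).toLinearMap ∘ₗ jetOp ik.2

theorem jetMap_apply {δ : ℕ} (ps : Fin δ → Fin 2 → ℂ) (f : MvPolynomial (Fin 2) ℂ)
    (ik : Fin δ × Fin 3) : jetMap ps f ik = eval (ps ik.1) (jetOp ik.2 f) := by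
  simp [jetMap, aeval_eq_eval]

theorem mem_multAtLeast_two {p : Fin 2 → ℂ} {f : MvPolynomial (Fin 2) ℂ} :
    f ∈ multAtLeast 2 p ↔ ∀ k, eval p (jetOp k f) = 0 := by
  have hcoeff (i : Fin 2) :
      coeff (Finsupp.single i 1) (translateBy p f) = eval p (pderiv i f) := by
    rw [← eval_zero_translateBy, ← pderiv_translateBy, eval_zero]
    simp [constantCoeff_eq, coeff_pderiv]
  have hcoeff0 : coeff 0 (translateBy p f) = eval p f := by
    rw [← eval_zero_translateBy, eval_zero, constantCoeff_eq]
  have hone : homogeneousComponent 1 (translateBy p f) = 0 ↔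
      ∀ i, coeff (Finsupp.single i 1) (translateBy p f) = 0 := by
    constructor
    · intro h i
      simpa [coeff_homogeneousComponent] using congrArg (coeff (Finsupp.single i 1)) h
    · intro h
      ext s
      rw [coeff_homogeneousComponent]
      split_ifs with hs
      · rw [Finsupp.degree_eq_sum, Fin.sum_univ_two] at hs
        have hsingle : s = Finsupp.single 0 1 ∨ s = Finsupp.single 1 1 := by
          simp only [Finsupp.ext_iff, Fin.forall_fin_two, Finsupp.single_apply]
          simp
          lia
        rcases hsingle with rfl | rfl
        exacts [h 0, h 1]
      · rfl
  rw [mem_multAtLeast]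
  have : (∀ k < 2, homogeneousComponent k (translateBy p f) = 0) ↔
      homogeneousComponent 0 (translateBy p f) = 0 ∧
        homogeneousComponent 1 (translateBy p f) = 0 :=
    ⟨fun h => ⟨h 0 (by lia), h 1 (by lia)⟩, fun h k hk => by interval_cases k; exacts [h.1, h.2]⟩
  rw [this, hone, homogeneousComponent_zero, C_eq_zero, hcoeff0]
  simp [hcoeff, jetOp, Fin.forall_fin_succ]

theorem mem_planeSystem_zero_iff {d m δ : ℕ} {ps : Fin δ → Fin 2 → ℂ}
    {f : MvPolynomial (Fin 2) ℂ} :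
    f ∈ planeSystem d m δ 0 ps ↔
      f ∈ restrictTotalDegree (Fin 2) ℂ d ⊓ multAtLeast m 0 ∧ jetMap ps f = 0 := by
  simp [planeSystem, Submodule.mem_iInf, mem_multAtLeast_two, funext_iff, jetMap_apply]

/-! ### Curves with an assigned multiplicity at the origin -/

theorem restrictTotalDegree_inf_multAtLeast_zero (d m : ℕ) :
    restrictTotalDegree (Fin 2) ℂ d ⊓ multAtLeast m 0 =
      restrictSupport ℂ {s : Fin 2 →₀ ℕ | m ≤ s.degree ∧ s.degree ≤ d} := by
  ext f
  rw [Submodule.mem_inf, mem_restrictTotalDegree, mem_multAtLeast, translateBy_zero,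
    mem_restrictSupport_iff, totalDegree, Finset.sup_le_iff]
  constructor
  · rintro ⟨hd, hm⟩ s hs
    refine ⟨?_, hd s hs⟩
    by_contra! hlt
    have := congrArg (coeff s) (hm _ hlt)
    simp only [LinearMap.id_apply, coeff_homogeneousComponent, if_true, coeff_zero] at this
    exact mem_support_iff.1 hs this
  · intro h
    refine ⟨fun s hs => (h hs).2, fun k hk => ?_⟩
    refine homogeneousComponent_eq_zero' _ _ fun s hs hsk => ?_
    have := (h hs).1
    lia

theorem mem_restrictSupport_of_isHomogeneous {d m k : ℕ} {F : MvPolynomial (Fin 2) ℂ}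
    (hF : F.IsHomogeneous k) (hm : m ≤ k) (hd : k ≤ d) :
    F ∈ restrictSupport ℂ {s : Fin 2 →₀ ℕ | m ≤ s.degree ∧ s.degree ≤ d} := by
  rw [mem_restrictSupport_iff]
  intro s hs
  have : s.degree = k := by
    by_contra h
    exact mem_support_iff.1 hs (hF.coeff_eq_zero h)
  simp [this, hm, hd]

theorem finite_setOf_degree (m d : ℕ) :
    {s : Fin 2 →₀ ℕ | m ≤ s.degree ∧ s.degree ≤ d}.Finite :=
  (Finsupp.finite_of_degree_le d).subset fun _ h => h.2

theorem finrank_restrictSupport_degree (m : ℕ) :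
    Module.finrank ℂ (restrictSupport ℂ
      {s : Fin 2 →₀ ℕ | m ≤ s.degree ∧ s.degree ≤ m + 4}) = 5 * m + 15 := by
  rw [Module.finrank_eq_nat_card_basis (basisRestrictSupport ℂ _)]
  let T : Finset (ℕ × ℕ) := (Finset.range 5).biUnion fun j => Finset.HasAntidiagonal.antidiagonal (m + j)
  have hcard : T.card = 5 * m + 15 := by
    rw [Finset.card_biUnion]
    · simp [Finset.sum_range_succ]; ring
    · intro i _ j _ hij
      rw [Function.onFun, Finset.disjoint_left]
      intro x hx hx'
      simp only [Finset.HasAntidiagonal.mem_antidiagonal] at hx hx'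
      lia
  rw [← hcard, ← Nat.card_eq_finsetCard]
  refine Nat.card_congr
    ((Finsupp.equivFunOnFinite.trans (finTwoArrowEquiv ℕ)).subtypeEquiv fun s => ?_)
  simp only [T, Set.mem_ofPred_eq, Finsupp.degree_eq_sum, Fin.sum_univ_two, Finset.mem_biUnion,
    Finset.mem_range, Finset.HasAntidiagonal.mem_antidiagonal]
  change _ ↔ ∃ j, j < 5 ∧ s 0 + s 1 = m + j
  exact ⟨fun h => ⟨s 0 + s 1 - m, by lia, by lia⟩, fun ⟨j, hj, h⟩ => by lia⟩

/-! ### Interpolation -/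

theorem exists_hermite_interpolation {ι : Type*} (s : Finset ι) (t u w : ι → ℂ)
    (ht : Set.InjOn t s) :
    ∃ P : Polynomial ℂ, P.degree < (2 * s.card : ℕ) ∧
      ∀ i ∈ s, P.eval (t i) = u i ∧ P.derivative.eval (t i) = w i := by
  classical
  set A := Lagrange.interpolate s t u with hA
  set N := Lagrange.nodal s t with hN
  set B := Lagrange.interpolate s t
    (fun i => (w i - A.derivative.eval (t i)) / N.derivative.eval (t i)) with hB
  have hAdeg : A.degree < s.card := Lagrange.degree_interpolate_lt _ ht
  have hBdeg : B.degree < s.card := Lagrange.degree_interpolate_lt _ ht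
  refine ⟨A + N * B, ?_, fun i hi => ?_⟩
  · have hcard : (s.card : WithBot ℕ) ≤ (2 * s.card : ℕ) := Nat.cast_le.2 (by lia)
    refine (Polynomial.degree_add_le _ _).trans_lt (max_lt (hAdeg.trans_le hcard) ?_)
    rw [Polynomial.degree_mul, Lagrange.degree_nodal, two_mul, Nat.cast_add]
    exact WithBot.add_lt_add_left (WithBot.natCast_ne_bot _) hBdeg
  · have hne : N.derivative.eval (t i) ≠ 0 := by
      have := Lagrange.nodalWeight_ne_zero ht hi
      rw [Lagrange.nodalWeight_eq_eval_derivative_nodal hi] at this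
      exact fun h => this (by rw [h, inv_zero])
    have hN0 : N.eval (t i) = 0 := Lagrange.eval_nodal_at_node hi
    have hBi := Lagrange.eval_interpolate_at_node
      (fun i => (w i - A.derivative.eval (t i)) / N.derivative.eval (t i)) ht hi
    rw [← hB] at hBi
    constructor
    · rw [Polynomial.eval_add, Polynomial.eval_mul, hN0, zero_mul, add_zero, hA,
        Lagrange.eval_interpolate_at_node _ ht hi]
    · simp only [Polynomial.derivative_add, Polynomial.derivative_mul, Polynomial.eval_add,
        Polynomial.eval_mul, hN0, hBi]
      field_simp
      ring

theorem exists_homogeneous_restrict_line {σ : ℂ} (hσ : σ ≠ 0) {d : ℕ} {P : Polynomial ℂ}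
    (hP : P.degree < (d + 1 : ℕ)) :
    ∃ F : MvPolynomial (Fin 2) ℂ, F.IsHomogeneous d ∧ ∀ y : ℂ,
      eval ![σ, y] F = P.eval y ∧ eval ![σ, y] (pderiv 1 F) = P.derivative.eval y := by
  have hPnat : P.natDegree < d + 1 := by
    by_cases h0 : P = 0
    · simp [h0]
    · exact (Polynomial.natDegree_lt_iff_degree_lt h0).2 hP
  refine ⟨∑ b ∈ Finset.range (d + 1), C (P.coeff b * (σ ^ (d - b))⁻¹) * (X 0 ^ (d - b) * X 1 ^ b),
    ?_, fun y => ⟨?_, ?_⟩⟩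
  · refine IsHomogeneous.sum _ _ _ fun b hb => IsHomogeneous.C_mul ?_ _
    have := (isHomogeneous_X_pow (R := ℂ) (0 : Fin 2) (d - b)).mul (isHomogeneous_X_pow 1 b)
    rwa [Nat.sub_add_cancel (by have := Finset.mem_range.1 hb; lia)] at this
  · rw [Polynomial.eval_eq_sum_range' hPnat, map_sum]
    refine Finset.sum_congr rfl fun b _ => ?_
    simp
    field_simp
  · conv_rhs => rw [P.as_sum_range' _ hPnat]
    simp only [map_sum, Polynomial.eval_finsetSum]
    refine Finset.sum_congr rfl fun b _ => ?_
    simp [Derivation.leibniz, Derivation.leibniz_pow, Polynomial.derivative_monomial]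
    field_simp

theorem exists_homogeneous_hermite {ι : Type*} (s : Finset ι) (t u w : ι → ℂ)
    (ht : Set.InjOn t s) {σ : ℂ} (hσ : σ ≠ 0) {d : ℕ} (hs : 2 * s.card ≤ d + 1) :
    ∃ F : MvPolynomial (Fin 2) ℂ, F.IsHomogeneous d ∧ ∀ i ∈ s,
      eval ![σ, t i] F = u i ∧ eval ![σ, t i] (pderiv 1 F) = w i := by
  obtain ⟨P, hP, hPi⟩ := exists_hermite_interpolation s t u w ht
  obtain ⟨F, hF, hFi⟩ := exists_homogeneous_restrict_line hσ
    (hP.trans_le (Nat.cast_le.2 hs))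
  exact ⟨F, hF, fun i hi => by rw [(hFi _).1, (hFi _).2]; exact hPi i hi⟩

theorem exists_homogeneous_lagrange {ι : Type*} (s : Finset ι) (t u : ι → ℂ)
    (ht : Set.InjOn t s) {σ : ℂ} (hσ : σ ≠ 0) {d : ℕ} (hs : s.card ≤ d + 1) :
    ∃ F : MvPolynomial (Fin 2) ℂ, F.IsHomogeneous d ∧ ∀ i ∈ s, eval ![σ, t i] F = u i := by
  classical
  obtain ⟨F, hF, hFi⟩ := exists_homogeneous_restrict_line hσ
    ((Lagrange.degree_interpolate_lt u ht).trans_le (Nat.cast_le.2 hs))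
  exact ⟨F, hF, fun i hi => by rw [(hFi _).1, Lagrange.eval_interpolate_at_node _ ht hi]⟩

/-- Curves with prescribed 1-jets at points of the two lines `x = 1` and `x = -1`. -/
theorem exists_jet_interpolation {ι : Type*} (A B : Finset ι) (t u v w : ι → ℂ)
    (ht : Function.Injective t) {m : ℕ} (hA : 2 * A.card ≤ m + 5) (hB : 2 * B.card ≤ m + 4) :
    ∃ f ∈ restrictSupport ℂ {s : Fin 2 →₀ ℕ | m ≤ s.degree ∧ s.degree ≤ m + 4},
      (∀ i ∈ A, eval ![1, t i] f = u i ∧ eval ![1, t i] (pderiv 0 f) = v i ∧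
        eval ![1, t i] (pderiv 1 f) = w i) ∧
      (∀ i ∈ B, eval ![-1, t i] f = u i ∧ eval ![-1, t i] (pderiv 0 f) = v i ∧
        eval ![-1, t i] (pderiv 1 f) = w i) := by
  have hneg : (-1 : ℂ) ≠ 0 := neg_ne_zero.2 one_ne_zero
  obtain ⟨F, hF, hFA⟩ := exists_homogeneous_hermite A t u w ht.injOn one_ne_zero
    (d := m + 4) hA
  obtain ⟨G, hG, hGB⟩ := exists_homogeneous_hermite B t
    (fun i => (u i - eval ![-1, t i] F) / (-2))
    (fun i => (w i - eval ![-1, t i] (pderiv 1 F)) / (-2)) ht.injOn hneg (d := m + 3) hB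
  obtain ⟨H, hH, hHA⟩ := exists_homogeneous_lagrange A t
    (fun i => (v i - eval ![1, t i] (pderiv 0 (F + (X 0 - 1) * G))) / 2) ht.injOn one_ne_zero
    (d := m + 2) (by lia)
  obtain ⟨K, hK, hKB⟩ := exists_homogeneous_lagrange B t
    (fun i => (v i - eval ![-1, t i] (pderiv 0 (F + (X 0 - 1) * G + (X 0 ^ 2 - 1) * H))) / 4)
    ht.injOn hneg (d := m + 1) (by lia)
  refine ⟨F + (X 0 - 1) * G + (X 0 ^ 2 - 1) * H + (X 0 - 1) ^ 2 * (X 0 + 1) * K, ?_, ?_, ?_⟩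
  · have hX (n k : ℕ) (P : MvPolynomial (Fin 2) ℂ) (hP : P.IsHomogeneous k) (hm : m ≤ k)
        (hnk : n + k ≤ m + 4) : X 0 ^ n * P ∈
          restrictSupport ℂ {s : Fin 2 →₀ ℕ | m ≤ s.degree ∧ s.degree ≤ m + 4} :=
      mem_restrictSupport_of_isHomogeneous ((isHomogeneous_X_pow 0 n).mul hP) (by lia) hnk
    have hsum : F + (X 0 - 1) * G + (X 0 ^ 2 - 1) * H + (X 0 - 1) ^ 2 * (X 0 + 1) * K =
        X 0 ^ 0 * F + (X 0 ^ 1 * G - X 0 ^ 0 * G) + (X 0 ^ 2 * H - X 0 ^ 0 * H) +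
          ((X 0 ^ 3 * K - X 0 ^ 2 * K) - (X 0 ^ 1 * K - X 0 ^ 0 * K)) := by ring
    rw [hsum]
    refine add_mem (add_mem (add_mem ?_ (sub_mem ?_ ?_)) (sub_mem ?_ ?_))
      (sub_mem (sub_mem ?_ ?_) (sub_mem ?_ ?_))
    all_goals exact hX _ _ _ ‹_› (by lia) (by lia)
  · intro i hi
    obtain ⟨h1, h2⟩ := hFA i hi
    have h3 := hHA i hi
    simp [Derivation.leibniz, Derivation.leibniz_pow, pderiv_X] at h1 h2 h3 ⊢
    refine ⟨h1, ?_, h2⟩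
    rw [h3]; ring
  · intro i hi
    obtain ⟨h1, h2⟩ := hGB i hi
    have h3 := hKB i hi
    simp [Derivation.leibniz, Derivation.leibniz_pow, pderiv_X] at h1 h2 h3 ⊢
    refine ⟨?_, ?_, ?_⟩
    · rw [h1]; ring
    · rw [h3]; ring
    · rw [h2]; ring

theorem exists_jetMap_surjective {m δ : ℕ} (hδ : δ ≤ m + 4) :
    ∃ ps : Fin δ → Fin 2 → ℂ, ∀ c : Fin δ × Fin 3 → ℂ,
      ∃ f ∈ restrictSupport ℂ {s : Fin 2 →₀ ℕ | m ≤ s.degree ∧ s.degree ≤ m + 4},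
        jetMap ps f = c := by
  refine ⟨fun i => ![if i.val < (m + 5) / 2 then 1 else -1, (i.val : ℂ)], fun c => ?_⟩
  let A : Finset (Fin δ) := {i | i.val < (m + 5) / 2}
  have hA : A.card ≤ (m + 5) / 2 := by
    simpa using Finset.card_le_card_of_injOn (t := Finset.range ((m + 5) / 2)) Fin.val
      (fun i hi => by simpa [A] using hi) Fin.val_injective.injOn
  have hB : Aᶜ.card ≤ δ - (m + 5) / 2 := by
    simpa using Finset.card_le_card_of_injOn (t := Finset.Ico ((m + 5) / 2) δ) Fin.val
      (fun i hi => by simpa [A] using hi) Fin.val_injective.injOn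
  obtain ⟨f, hf, hfA, hfB⟩ := exists_jet_interpolation A Aᶜ (fun i => (i.val : ℂ))
    (fun i => c (i, 0)) (fun i => c (i, 1)) (fun i => c (i, 2))
    (fun i j hij => Fin.val_injective (Nat.cast_injective hij)) (m := m) (by lia) (by lia)
  refine ⟨f, hf, funext fun ik => ?_⟩
  obtain ⟨i, k⟩ := ik
  rw [jetMap_apply]
  by_cases hi : i.val < (m + 5) / 2
  · obtain ⟨h0, h1, h2⟩ := hfA i (by simpa [A] using hi)
    simp only [hi, if_true]
    fin_cases k
    exacts [h0, h1, h2]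
  · obtain ⟨h0, h1, h2⟩ := hfB i (by simpa [A] using hi)
    simp only [hi, if_false]
    fin_cases k
    exacts [h0, h1, h2]

/-! ### General configurations -/

theorem finrank_planeSystem_zero {m δ : ℕ} {ps : Fin δ → Fin 2 → ℂ}
    (hps : ∀ c : Fin δ × Fin 3 → ℂ,
      ∃ f ∈ restrictSupport ℂ {s : Fin 2 →₀ ℕ | m ≤ s.degree ∧ s.degree ≤ m + 4},
        jetMap ps f = c) :
    Module.finrank ℂ (planeSystem (m + 4) m δ 0 ps) + 3 * δ = 5 * m + 15 := by
  set V := restrictSupport ℂ {s : Fin 2 →₀ ℕ | m ≤ s.degree ∧ s.degree ≤ m + 4} with hV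
  have : Finite {s : Fin 2 →₀ ℕ | m ≤ s.degree ∧ s.degree ≤ m + 4} :=
    finite_setOf_degree m (m + 4)
  have : Module.Finite ℂ V := Module.Finite.of_basis (basisRestrictSupport ℂ _)
  let Φ : V →ₗ[ℂ] (Fin δ × Fin 3 → ℂ) := (jetMap ps).domRestrict V
  have hΦ : Φ.range = ⊤ := by
    rw [LinearMap.range_eq_top]
    intro c
    obtain ⟨f, hf, hfc⟩ := hps c
    exact ⟨⟨f, hf⟩, hfc⟩
  have hker : planeSystem (m + 4) m δ 0 ps = Φ.ker.map V.subtype := by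
    ext f
    rw [mem_planeSystem_zero_iff, restrictTotalDegree_inf_multAtLeast_zero]
    simp [Φ, hV, and_comm]
  have hrank := Φ.finrank_range_add_finrank_ker
  rw [hΦ, finrank_top, finrank_restrictSupport_degree, Module.finrank_fintype_fun_eq_card,
    Fintype.card_prod, Fintype.card_fin, Fintype.card_fin] at hrank
  rw [hker, Submodule.finrank_map_subtype_eq]
  lia

theorem analyticOnNhd_matrix_det {E n : Type*} [NormedAddCommGroup E] [NormedSpace ℂ E]
    [Fintype n] [DecidableEq n] {M : E → Matrix n n ℂ} {s : Set E}
    (hM : ∀ i j, AnalyticOnNhd ℂ (fun x => M x i j) s) :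
    AnalyticOnNhd ℂ (fun x => (M x).det) s := by
  simp only [Matrix.det_apply']
  refine Finset.analyticOnNhd_fun_sum _ fun τ _ => ?_
  exact analyticOnNhd_const.mul (Finset.analyticOnNhd_fun_prod _ fun i _ => hM _ _)

theorem isOpen_dense_setOf_ne_zero {E : Type*} [NormedAddCommGroup E] [NormedSpace ℂ E]
    {D : E → ℂ} (hD : AnalyticOnNhd ℂ D Set.univ) {x₀ : E} (hx₀ : D x₀ ≠ 0) :
    IsOpen {x | D x ≠ 0} ∧ Dense {x | D x ≠ 0} := by
  have hcont : Continuous D := continuousOn_univ.1 hD.continuousOn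
  refine ⟨isOpen_ne_fun hcont continuous_const, fun x => ?_⟩
  by_contra hx
  have hev : D =ᶠ[nhds x] 0 := by
    filter_upwards [isClosed_closure.isOpen_compl.mem_nhds hx] with y hy
    by_contra hy0
    exact hy (subset_closure hy0)
  exact hx₀ (hD.eqOn_zero_of_preconnected_of_eventuallyEq_zero isPreconnected_univ
    (Set.mem_univ x) hev (Set.mem_univ x₀))

theorem exists_isOpen_dense_finrank_planeSystem {m δ : ℕ} (hδ : δ ≤ m + 4) :
    ∃ U : Set ((Fin 2 → ℂ) × (Fin δ → Fin 2 → ℂ)), IsOpen U ∧ Dense U ∧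
      ∀ cfg ∈ U,
        Module.finrank ℂ (planeSystem (m + 4) m δ cfg.1 cfg.2) + 3 * δ = 5 * m + 15 := by
  classical
  obtain ⟨qs, hqs⟩ := exists_jetMap_surjective hδ
  choose f hfV hf using fun j : Fin δ × Fin 3 => hqs (Pi.single j 1)
  let M (cfg : (Fin 2 → ℂ) × (Fin δ → Fin 2 → ℂ)) : Matrix (Fin δ × Fin 3) (Fin δ × Fin 3) ℂ :=
    Matrix.of fun i j => jetMap (fun k => cfg.2 k - cfg.1) (f j) i
  have hM : AnalyticOnNhd ℂ (fun cfg => (M cfg).det) Set.univ := by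
    refine analyticOnNhd_matrix_det fun i j => ?_
    simp only [M, Matrix.of_apply, jetMap_apply, ← aeval_eq_eval]
    refine AnalyticOnNhd.aeval_mvPolynomial (fun k => ?_) _
    have : (fun cfg : (Fin 2 → ℂ) × (Fin δ → Fin 2 → ℂ) => (cfg.2 i.1 - cfg.1) k) =
      (ContinuousLinearMap.proj k ∘L (ContinuousLinearMap.proj i.1 ∘L
        ContinuousLinearMap.snd ℂ (Fin 2 → ℂ) (Fin δ → Fin 2 → ℂ) -
          ContinuousLinearMap.fst ℂ (Fin 2 → ℂ) (Fin δ → Fin 2 → ℂ)) : _ →L[ℂ] ℂ) := rfl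
    rw [this]
    exact ContinuousLinearMap.analyticOnNhd _ _
  have hM0 : (M (0, qs)).det ≠ 0 := by
    have : M (0, qs) = 1 := by
      ext i j
      simp [M, hf, Matrix.one_apply, Pi.single_apply]
    simp [this]
  obtain ⟨hopen, hdense⟩ := isOpen_dense_setOf_ne_zero hM hM0
  refine ⟨_, hopen, hdense, fun cfg hcfg => ?_⟩
  rw [finrank_planeSystem_translate]
  refine finrank_planeSystem_zero fun c => ?_
  have hunit : IsUnit (M cfg).det := isUnit_iff_ne_zero.2 hcfg
  refine ⟨∑ j, ((M cfg)⁻¹.mulVec c) j • f j,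
    sum_mem fun j _ => Submodule.smul_mem _ _ (hfV j), ?_⟩
  have hmul : (M cfg).mulVec ((M cfg)⁻¹.mulVec c) = c := by
    rw [Matrix.mulVec_mulVec, Matrix.mul_nonsing_inv _ hunit, Matrix.one_mulVec]
  rw [map_sum]
  conv_rhs => rw [← hmul]
  ext i
  rw [Finset.sum_apply]
  refine Finset.sum_congr rfl fun j _ => ?_
  rw [map_smul, Pi.smul_apply, smul_eq_mul, mul_comm]
  rfl

/-- **Claim 3.1.**  With `g = 2h + ε ≥ 5`, `n = h + 3 + ε`, `δ = h + 2ε`, for general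
points `p, p₁, …, p_δ` the system `L_{n−2}(p^{n−6}, p₁², …, p_δ²)` has the expected
(projective) dimension `(n−2)(n+1)/2 − (n−6)(n−5)/2 − 3δ = 2h − 1 − ε`, i.e. the
corresponding space of polynomials has `ℂ`-dimension `2h − ε`. -/
theorem plane_system_expected_dimension
    (g h ε : ℕ) (hε : ε ≤ 1) (hgdef : g = 2 * h + ε) (hg : 5 ≤ g)
    (n δ : ℕ) (hn : n = h + 3 + ε) (hδ : δ = h + 2 * ε) :
    (((n : ℤ) - 2) * ((n : ℤ) + 1)) / 2 - (((n : ℤ) - 6) * ((n : ℤ) - 5)) / 2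
        - 3 * (δ : ℤ) = 2 * (h : ℤ) - 1 - (ε : ℤ) ∧
    ∃ U : Set ((Fin 2 → ℂ) × (Fin δ → Fin 2 → ℂ)), IsOpen U ∧ Dense U ∧
      ∀ cfg ∈ U,
        Module.finrank ℂ (planeSystem (n - 2) (n - 6) δ cfg.1 cfg.2) = 2 * h - ε := by
  obtain ⟨m, rfl⟩ : ∃ m, n = m + 6 := ⟨n - 6, by lia⟩
  constructor
  · have h1 : ((m + 6 : ℕ) - 2 : ℤ) * ((m + 6 : ℕ) + 1) =
        ((m + 6 : ℕ) - 6 : ℤ) * ((m + 6 : ℕ) - 5) + (5 * m + 14) * 2 := by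
      push_cast
      ring
    rw [h1, Int.add_mul_ediv_right _ _ two_ne_zero]
    lia
  · obtain ⟨U, hopen, hdense, hU⟩ :=
      exists_isOpen_dense_finrank_planeSystem (m := m) (δ := δ) (by lia)
    refine ⟨U, hopen, hdense, fun cfg hcfg => ?_⟩
    have := hU cfg hcfg
    rw [show m + 6 - 2 = m + 4 by lia, show m + 6 - 6 = m by lia]
    lia
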